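/- Let G=(V,E) be a supply graph and H=(V,D) a demand graph with G+H connected. Then the optimum value of the D-cut packing LP (maximize Σ_{U∈𝓤} f_U subject to: for every edge e of G+H, Σ_{U∈𝓤: e∈δ(U)} f_U ≤ 1, and f ≥ 0, where 𝓤 is the set of vertex sets U such that δ(U) is a D-cut) equals the optimum value of the nonnegative cycle LP (maximize Σ_{e∈D} x_e subject to Σ_{e∈C∩D} x_e ≤ |C∩E| for every cycle C, and 0 ≤ x_e ≤ 1). -/

import Mathlib

open scoped Classical

noncomputable section

/-- The edge set of a simple closed walk in the multigraph with endpoint map `ends`. -/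
def IsCycle {V ε : Type} (ends : ε → Sym2 V) (C : Finset ε) : Prop :=
  ∃ (n : ℕ) (v : Fin (n + 1) → V) (e : Fin (n + 1) → ε),
    Function.Injective v ∧ Function.Injective e ∧
    (∀ i, ends (e i) = s(v i, v (i + 1))) ∧
    C = Finset.image e Finset.univ

/-- The edge set of a simple (open) path. -/
def IsPath {V ε : Type} (ends : ε → Sym2 V) (P : Finset ε) : Prop :=
  ∃ (n : ℕ) (v : Fin (n + 1) → V) (e : Fin n → ε),
    Function.Injective v ∧ Function.Injective e ∧
    (∀ i : Fin n, ends (e i) = s(v i.castSucc, v i.succ)) ∧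
    P = Finset.image e Finset.univ

/-- The cut `δ(U)`: edges with exactly one endpoint in `U`. -/
def cutF {V ε : Type} [Fintype ε] (ends : ε → Sym2 V) (U : Set V) : Finset ε :=
  Finset.univ.filter (fun e => ∃ a b, ends e = s(a, b) ∧ a ∈ U ∧ b ∉ U)

/-- `U` is nonempty and induces a connected subgraph. -/
def ConnectedOn {V ε : Type} (ends : ε → Sym2 V) (U : Set V) : Prop :=
  U.Nonempty ∧ ∀ a ∈ U, ∀ b ∈ U,
    Relation.ReflTransGen (fun x y => x ∈ U ∧ y ∈ U ∧ ∃ e, ends e = s(x, y)) a b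

/-- The multigraph is connected. -/
def MGConnected {V ε : Type} (ends : ε → Sym2 V) : Prop :=
  ConnectedOn ends Set.univ

/-- `δ(U)` is a simple cut: both sides induce connected subgraphs. -/
def IsSimpleCut {V ε : Type} (ends : ε → Sym2 V) (U : Set V) : Prop :=
  ConnectedOn ends U ∧ ConnectedOn ends Uᶜ

/-- A `D`-cycle: a cycle containing exactly one demand edge. -/
def IsDCycle {V ε : Type} [DecidableEq ε] (ends : ε → Sym2 V) (Dem : Finset ε)
    (C : Finset ε) : Prop :=
  IsCycle ends C ∧ (C ∩ Dem).card = 1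

/-- A `D`-cut: a simple cut containing exactly one demand edge. -/
def IsDCut {V ε : Type} [Fintype ε] [DecidableEq ε] (ends : ε → Sym2 V) (Dem : Finset ε)
    (U : Set V) : Prop :=
  IsSimpleCut ends U ∧ (cutF ends U ∩ Dem).card = 1

/-- Planarity of a multigraph: there is a drawing in the plane with injective vertex
positions and arcs for the edges that are internally disjoint. -/
def IsPlanar {V ε : Type} (ends : ε → Sym2 V) : Prop :=
  ∃ (pos : V → ℝ × ℝ) (arc : ε → ℝ → ℝ × ℝ),
    Function.Injective pos ∧
    (∀ e, ContinuousOn (arc e) (Set.Icc 0 1)) ∧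
    (∀ e a b, ends e = s(a, b) →
      (arc e 0 = pos a ∧ arc e 1 = pos b) ∨ (arc e 0 = pos b ∧ arc e 1 = pos a)) ∧
    (∀ e, Set.InjOn (arc e) (Set.Ico 0 1)) ∧
    (∀ e f, e ≠ f → ∀ s ∈ Set.Ioo (0:ℝ) 1, ∀ t ∈ Set.Icc (0:ℝ) 1, arc e s ≠ arc f t) ∧
    (∀ e, ∀ s ∈ Set.Ioo (0:ℝ) 1, ∀ w, arc e s ≠ pos w)

/-- `MWalk ends u v l` says that the edge list `l` is traversed by a walk from `u` to `v`. -/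
inductive MWalk {V ε : Type} (ends : ε → Sym2 V) : V → V → List ε → Prop
  | nil (v : V) : MWalk ends v v []
  | cons {u v z : V} {e : ε} {l : List ε} (he : ends e = s(u, v)) (h : MWalk ends v z l) :
      MWalk ends u z (e :: l)

namespace MWalk

variable {V ε : Type} {ends : ε → Sym2 V}

lemma append {u v z : V} {l m : List ε} (h : MWalk ends u v l) (h' : MWalk ends v z m) :
    MWalk ends u z (l ++ m) := by
  induction h with
  | nil => exact h'
  | cons he _ ih => exact .cons he (ih h')

lemma single {u v : V} {e : ε} (he : ends e = s(u, v)) : MWalk ends u v [e] :=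
  .cons he (.nil v)

lemma reverse {u v : V} {l : List ε} (h : MWalk ends u v l) : MWalk ends v u l.reverse := by
  induction h with
  | nil => exact .nil _
  | cons he _ ih =>
    rw [List.reverse_cons]
    exact ih.append (single (he.trans Sym2.eq_swap))

lemma eq_of_nil {u v : V} (h : MWalk ends u v []) : u = v := by
  cases h; rfl

lemma of_cons {u z : V} {e : ε} {l : List ε} (h : MWalk ends u z (e :: l)) :
    ∃ v, ends e = s(u, v) ∧ MWalk ends v z l := by
  cases h with
  | cons he h => exact ⟨_, he, h⟩

lemma of_append {l m : List ε} {u z : V} (h : MWalk ends u z (l ++ m)) :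
    ∃ v, MWalk ends u v l ∧ MWalk ends v z m := by
  induction l generalizing u with
  | nil => exact ⟨u, .nil u, h⟩
  | cons e l ih =>
    obtain ⟨v, he, h⟩ := of_cons h
    obtain ⟨x, h1, h2⟩ := ih h
    exact ⟨x, .cons he h1, h2⟩

lemma of_append_cons {l m : List ε} {e : ε} {u z : V} (h : MWalk ends u z (l ++ e :: m)) :
    ∃ p q, MWalk ends u p l ∧ ends e = s(p, q) ∧ MWalk ends q z m := by
  obtain ⟨p, h1, h2⟩ := h.of_append
  obtain ⟨q, he, h3⟩ := h2.of_cons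
  exact ⟨p, q, h1, he, h3⟩

/-- A walk through an edge visits both endpoints of that edge. -/
lemma split_at_endpoint {l m : List ε} {e : ε} {u z t t' : V}
    (h : MWalk ends u z (l ++ e :: m)) (he : ends e = s(t, t')) :
    (MWalk ends u t l ∧ MWalk ends t z (e :: m)) ∨
      (MWalk ends u t (l ++ [e]) ∧ MWalk ends t z m) := by
  obtain ⟨p, q, h1, he', h2⟩ := h.of_append_cons
  rw [he', Sym2.eq_iff] at he
  rcases he with ⟨rfl, rfl⟩ | ⟨rfl, rfl⟩
  · exact .inl ⟨h1, .cons he' h2⟩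
  · exact .inr ⟨h1.append (single he'), h2⟩

lemma map {V' : Type} (φ : V → V') {u v : V} {l : List ε} (h : MWalk ends u v l) :
    MWalk (fun e => (ends e).map φ) (φ u) (φ v) l := by
  induction h with
  | nil => exact .nil _
  | cons he _ ih => exact .cons (by simp [he]) ih

end MWalk

/-- Total weight of a list of edges. -/
def listWeight {ε : Type} (w : ε → ℝ) (l : List ε) : ℝ := (l.map w).sum

section listWeight

variable {ε : Type} (w : ε → ℝ)

@[simp] lemma listWeight_nil : listWeight w [] = 0 := rfl

@[simp] lemma listWeight_cons (e : ε) (l : List ε) :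
    listWeight w (e :: l) = w e + listWeight w l := by simp [listWeight]

@[simp] lemma listWeight_append (l m : List ε) :
    listWeight w (l ++ m) = listWeight w l + listWeight w m := by simp [listWeight]

@[simp] lemma listWeight_reverse (l : List ε) :
    listWeight w l.reverse = listWeight w l := by
  induction l with
  | nil => rfl
  | cons e l ih => simp [ih, add_comm]

lemma listWeight_eq_sum {l : List ε} (hl : l.Nodup) :
    listWeight w l = ∑ e ∈ l.toFinset, w e := by
  rw [List.sum_toFinset _ hl]; rfl

lemma listWeight_nonpos {l : List ε} (h : ∀ e ∈ l, w e ≤ 0) : listWeight w l ≤ 0 := by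
  induction l with
  | nil => simp
  | cons e l ih =>
    have h1 := h e (by simp)
    have h2 := ih fun e he => h e (by simp [he])
    simp only [listWeight_cons]
    linarith

end listWeight

lemma List.exists_split_first {α : Type} (p : α → Prop) {l : List α} (h : ∃ a ∈ l, p a) :
    ∃ l₁ a l₂, l = l₁ ++ a :: l₂ ∧ p a ∧ ∀ b ∈ l₁, ¬ p b := by
  induction l with
  | nil => simp at h
  | cons c l ih =>
    by_cases hc : p c
    · exact ⟨[], c, l, rfl, hc, by simp⟩
    · obtain ⟨l₁, a, l₂, rfl, ha, h'⟩ := ih (by simpa [hc] using h)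
      exact ⟨c :: l₁, a, l₂, rfl, ha, by simpa [hc] using h'⟩

/-- The signed indicator of a cut `B` with distinguished edge `f`. -/
def cutSign {ε : Type} (B : Set ε) (f e : ε) : ℝ :=
  if e = f then -1 else if e ∈ B then 1 else 0

/-- If no edge of `B` in the list is followed by another one, the signed count is at most one. -/
lemma listWeight_cutSign_le_one {ε : Type} (B : Set ε) (f : ε) {l : List ε}
    (h : ∀ l₁ e l₂, l = l₁ ++ e :: l₂ → e ∈ B → ∀ g ∈ l₂, g ∉ B) :
    listWeight (cutSign B f) l ≤ 1 := by
  induction l with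
  | nil => simp
  | cons e l ih =>
    rw [listWeight_cons]
    by_cases he : e ∈ B
    · have h1 : listWeight (cutSign B f) l ≤ 0 := by
        refine listWeight_nonpos _ fun g hg => ?_
        have := h [] e l rfl he g hg
        unfold cutSign; split_ifs <;> norm_num
      have h2 : cutSign B f e ≤ 1 := by unfold cutSign; split_ifs <;> norm_num
      linarith
    · have h1 := ih fun l₁ g l₂ hl => h (e :: l₁) g l₂ (by simp [hl])
      have h2 : cutSign B f e ≤ 0 := by unfold cutSign; split_ifs <;> norm_num
      linarith

/-- The edges joining `b` to another vertex. -/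
def starCut {V ε : Type} (ends : ε → Sym2 V) (b : V) : Set ε :=
  {e | ∃ c, c ≠ b ∧ ends e = s(b, c)}

section Star

variable {V ε : Type} {ends : ε → Sym2 V} {w : ε → ℝ}

/-- A trail to `x₀` of minimum weight, and among those of minimum length. -/
def IsMinTrail (ends : ε → Sym2 V) (w : ε → ℝ) (x₀ b : V) (P : List ε) : Prop :=
  MWalk ends b x₀ P ∧ P.Nodup ∧ ∀ v l, MWalk ends v x₀ l → l.Nodup →
    listWeight w P ≤ listWeight w l ∧ (l.length < P.length → listWeight w P < listWeight w l)

lemma exists_isMinTrail [Fintype ε] (ends : ε → Sym2 V) (w : ε → ℝ) (x₀ : V) :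
    ∃ b P, IsMinTrail ends w x₀ b P := by
  let s : Set {l : List ε // l.Nodup} := {l | ∃ v, MWalk ends v x₀ l.1}
  obtain ⟨⟨P, hP⟩, ⟨b, hb⟩, hmin⟩ := Set.exists_min_image s
    (fun l => toLex (listWeight w l.1, l.1.length)) s.toFinite
    ⟨⟨[], List.nodup_nil⟩, x₀, .nil x₀⟩
  refine ⟨b, P, hb, hP, fun v l hv hl => ?_⟩
  have := hmin ⟨l, hl⟩ ⟨v, hv⟩
  rw [Prod.Lex.le_iff] at this
  simp only [ofLex_toLex] at this
  rcases this with h | ⟨h1, h2⟩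
  · exact ⟨h.le, fun _ => h⟩
  · exact ⟨h1.le, fun h => absurd h2 (by omega)⟩

variable (hcons : ∀ v l, MWalk ends v v l → l.Nodup → 0 ≤ listWeight w l)

include hcons in
lemma IsMinTrail.unique_neg {x₀ b : V} {f : ε} {P : List ε}
    (h : IsMinTrail ends w x₀ b (f :: P)) {g : ε} (hg : g ∈ starCut ends b) (hwg : w g < 0) :
    g = f := by
  obtain ⟨hP, hnd, hmin⟩ := h
  obtain ⟨c, hc, hgc⟩ := hg
  by_contra hne
  by_cases hgP : g ∈ f :: P
  · have hgP' : g ∈ P := by simpa [hne] using hgP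
    obtain ⟨A, B, rfl⟩ := List.append_of_mem hgP'
    rw [← List.cons_append] at hP hnd hmin
    rcases hP.split_at_endpoint hgc with ⟨h1, h2⟩ | ⟨h1, h2⟩
    · have hA := hcons _ _ h1 (hnd.sublist (List.sublist_append_left _ _))
      have := (hmin _ _ h2 (hnd.sublist (List.sublist_append_right _ _))).2 (by simp)
      simp only [listWeight_append, listWeight_cons] at *
      linarith
    · have e1 : (f :: A) ++ g :: B = ((f :: A) ++ [g]) ++ B := by simp
      rw [e1] at hnd hmin
      have hA := hcons _ _ h1 (hnd.sublist (List.sublist_append_left _ _))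
      have := (hmin _ _ h2 (hnd.sublist (List.sublist_append_right _ _))).2 (by simp; omega)
      simp only [listWeight_append, listWeight_cons] at *
      linarith
  · have := (hmin c (g :: f :: P) (.cons (hgc.trans Sym2.eq_swap) hP)
      (List.nodup_cons.2 ⟨hgP, hnd⟩)).1
    simp only [listWeight_cons] at this
    linarith

include hcons in
/-- A tight closed trail at the end of a minimum trail that avoids its first edge cannot start
with an edge of positive weight. -/
lemma IsMinTrail.not_tight {x₀ b : V} {f : ε} {P : List ε}
    (h : IsMinTrail ends w x₀ b (f :: P)) {g : ε} {Y : List ε}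
    (hX : MWalk ends b b (g :: Y)) (hXnd : (g :: Y).Nodup) (hf : f ∉ g :: Y)
    (hg : 0 < w g) : 0 < listWeight w (g :: Y) := by
  by_contra! hle
  obtain ⟨hP, hnd, hmin⟩ := h
  by_cases hdisj : ∃ e ∈ f :: P, e ∈ g :: Y
  · obtain ⟨P₂, e, P₁, hPe, heX, hP₂⟩ := List.exists_split_first _ hdisj
    have hP₂ne : P₂ ≠ [] := by
      rintro rfl
      simp only [List.nil_append, List.cons.injEq] at hPe
      exact hf (hPe.1 ▸ heX)
    rw [hPe] at hP hnd hmin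
    obtain ⟨t, t', h1, he, h2⟩ := hP.of_append_cons
    have key : ∃ Y₁ Y₂, g :: Y = Y₁ ++ Y₂ ∧ MWalk ends b t Y₁ ∧ MWalk ends t b Y₂ := by
      obtain ⟨X₁, X₂, hXe⟩ := List.append_of_mem heX
      rw [hXe] at hX
      rcases hX.split_at_endpoint he with h | h
      · exact ⟨X₁, e :: X₂, hXe, h⟩
      · exact ⟨X₁ ++ [e], X₂, by simp [hXe], h⟩
    obtain ⟨Y₁, Y₂, hY, hY₁, hY₂⟩ := key
    rw [hY] at hXnd hle hP₂
    rw [List.nodup_append'] at hXnd hnd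
    have d1 : (P₂ ++ Y₂).Nodup := by
      refine List.nodup_append'.2 ⟨hnd.1, hXnd.2.1, fun a ha hb => hP₂ a ha ?_⟩
      simp [hb]
    have d2 : (Y₁ ++ P₂.reverse).Nodup := by
      refine List.nodup_append'.2 ⟨hXnd.1, List.nodup_reverse.2 hnd.1, fun a ha hb => hP₂ a ?_ ?_⟩
      · simpa using hb
      · simp [ha]
    have c1 := hcons _ _ (h1.append hY₂) d1
    have c2 := hcons _ _ (hY₁.append h1.reverse) d2
    have := (hmin _ _ (MWalk.cons he h2) hnd.2.1).2
      (by simpa using List.length_pos_of_ne_nil hP₂ne)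
    simp only [listWeight_append, listWeight_cons, listWeight_reverse] at *
    linarith
  · push Not at hdisj
    obtain ⟨c, hc, hY⟩ := hX.of_cons
    have := (hmin c (Y ++ f :: P) (hY.append hP) (List.nodup_append'.2
      ⟨(List.nodup_cons.1 hXnd).2, hnd, fun a ha hb => hdisj a hb (by simp [ha])⟩)).1
    simp only [listWeight_append, listWeight_cons] at *
    linarith

variable (hzero : ∀ e a b, ends e = s(a, b) → w e = 0 → a = b)

include hcons hzero in
lemma IsMinTrail.disjoint_star_of_tight {x₀ b : V} {f : ε} {P : List ε}
    (h : IsMinTrail ends w x₀ b (f :: P)) {L : List ε} (hL : MWalk ends b b L) (hnd : L.Nodup)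
    (ht : listWeight w L = 0) (hf : f ∉ L) : ∀ e ∈ L, e ∉ starCut ends b := by
  intro e he heb
  have hpos : 0 < w e := by
    rcases lt_trichotomy (w e) 0 with h1 | h1 | h1
    · exact absurd (h.unique_neg hcons heb h1 ▸ he) hf
    · obtain ⟨c, hc, hec⟩ := heb
      exact absurd (hzero _ _ _ hec h1).symm hc
    · exact h1
  obtain ⟨c, hc, hec⟩ := heb
  obtain ⟨A, B, rfl⟩ := List.append_of_mem he
  rcases hL.split_at_endpoint hec with ⟨h1, h2⟩ | ⟨h1, h2⟩
  · have c1 := hcons _ _ h1 (hnd.sublist (List.sublist_append_left _ _))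
    have := h.not_tight hcons h2 (hnd.sublist (List.sublist_append_right _ _))
      (fun h' => hf (by simp only [List.mem_append]; exact .inr h')) hpos
    simp only [listWeight_append, listWeight_cons] at *
    linarith
  · rw [show A ++ e :: B = (A ++ [e]) ++ B by simp] at hnd ht hf
    have c1 := hcons _ _ h2 (hnd.sublist (List.sublist_append_right _ _))
    have h3 := h1.reverse
    have hnd' := List.nodup_reverse.2 (hnd.sublist (List.sublist_append_left _ _))
    simp only [List.reverse_append, List.reverse_cons, List.reverse_nil, List.nil_append,
      List.singleton_append] at h3 hnd'
    have := h.not_tight hcons h3 hnd'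
      (fun h' => hf (by simp at h' ⊢; tauto)) hpos
    simp only [listWeight_append, listWeight_cons, listWeight_reverse, listWeight_nil] at *
    linarith

lemma cutSign_nonpos_of_notMem {B : Set ε} {f e : ε} (h : e ∉ B) : cutSign B f e ≤ 0 := by
  unfold cutSign; split_ifs <;> norm_num

include hcons hzero in
lemma IsMinTrail.sign_nonpos_of_tight {x₀ b : V} {f : ε} {P : List ε}
    (h : IsMinTrail ends w x₀ b (f :: P)) {L : List ε} (hL : MWalk ends b b L) (hnd : L.Nodup)
    (ht : listWeight w L = 0) : listWeight (cutSign (starCut ends b) f) L ≤ 0 := by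
  have hdis := fun {L : List ε} => h.disjoint_star_of_tight hcons hzero (L := L)
  by_cases hf : f ∈ L
  swap
  · exact listWeight_nonpos _ fun e he => cutSign_nonpos_of_notMem (hdis hL hnd ht hf e he)
  have hstart : ∀ A B, MWalk ends b b A → MWalk ends b b (f :: B) → (A ++ f :: B).Nodup →
      listWeight w (A ++ f :: B) = 0 →
      listWeight (cutSign (starCut ends b) f) (A ++ f :: B) ≤ 0 := by
    intro A B hA hB hnd ht
    rw [listWeight_append] at ht
    have hnd' := List.nodup_append'.1 hnd
    have c1 := hcons _ _ hA hnd'.1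
    have c2 := hcons _ _ hB hnd'.2.1
    have hfA : f ∉ A := fun h' => hnd'.2.2 h' (by simp)
    have s1 : listWeight (cutSign (starCut ends b) f) A ≤ 0 :=
      listWeight_nonpos _ fun e he => cutSign_nonpos_of_notMem
        (hdis hA hnd'.1 (by linarith) hfA e he)
    have s2 : listWeight (cutSign (starCut ends b) f) B ≤ 1 := by
      refine listWeight_cutSign_le_one _ _ ?_
      rintro B₁ e B₂ rfl heb g hg
      have hnd2 := hnd'.2.1
      rw [← List.cons_append] at hB hnd2 c2 ht
      have hnd3 := List.nodup_append'.1 hnd2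
      have hfB : f ∉ e :: B₂ := fun h' => hnd3.2.2 (by simp) h'
      obtain ⟨c, hc, hec⟩ := id heb
      rcases hB.split_at_endpoint hec with ⟨h1, h2⟩ | ⟨h1, h2⟩
      · have d1 := hcons _ _ h1 hnd3.1
        have d2 := hcons _ _ h2 hnd3.2.1
        rw [listWeight_append] at ht
        exact absurd heb (hdis h2 hnd3.2.1 (by linarith) hfB e (by simp))
      · rw [show (f :: B₁) ++ e :: B₂ = ((f :: B₁) ++ [e]) ++ B₂ by simp] at hnd2 ht
        have hnd4 := List.nodup_append'.1 hnd2
        have d1 := hcons _ _ h1 hnd4.1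
        have d2 := hcons _ _ h2 hnd4.2.1
        rw [listWeight_append] at ht
        exact hdis h2 hnd4.2.1 (by linarith) (fun h' => hfB (by simp [h'])) g hg
    have s3 : cutSign (starCut ends b) f f = -1 := by simp [cutSign]
    rw [listWeight_append, listWeight_cons]
    linarith
  have hfb : ∃ c, ends f = s(b, c) := by
    obtain ⟨c, hc, -⟩ := h.1.of_cons
    exact ⟨c, hc⟩
  obtain ⟨c, hfc⟩ := hfb
  obtain ⟨A, B, rfl⟩ := List.append_of_mem hf
  rcases hL.split_at_endpoint hfc with ⟨h1, h2⟩ | ⟨h1, h2⟩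
  · exact hstart A B h1 h2 hnd ht
  · have h3 := h1.reverse
    rw [List.reverse_append, List.reverse_singleton, List.singleton_append] at h3
    have e1 : B.reverse ++ f :: A.reverse = (A ++ f :: B).reverse := by simp
    have := hstart B.reverse A.reverse h2.reverse h3 (by rw [e1]; exact List.nodup_reverse.2 hnd)
      (by rw [e1, listWeight_reverse]; exact ht)
    rwa [e1, listWeight_reverse] at this

include hcons hzero in
/-- In a conservatively weighted multigraph with a negative edge whose weight-zero edges are
loops, some vertex star contains exactly one negative edge and crosses every tight closed trail
in at most as many positive as negative edges. -/
lemma exists_star_cut [Fintype ε] (hneg : ∃ d, w d < 0) :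
    ∃ b f, f ∈ starCut ends b ∧ w f < 0 ∧ (∀ g ∈ starCut ends b, w g < 0 → g = f) ∧
      ∀ v l, MWalk ends v v l → l.Nodup → listWeight w l = 0 →
        listWeight (cutSign (starCut ends b) f) l ≤ 0 := by
  obtain ⟨d, hd⟩ := hneg
  obtain ⟨x₀, a, hda⟩ : ∃ x a, ends d = s(x, a) := by
    induction ends d using Sym2.ind with
    | _ x y => exact ⟨x, y, rfl⟩
  obtain ⟨b, P, hP⟩ := exists_isMinTrail ends w x₀
  have hlt : listWeight w P < 0 := by
    have := (hP.2.2 a [d] (.single (hda.trans Sym2.eq_swap)) (by simp)).1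
    simp only [listWeight_cons, listWeight_nil] at this
    linarith
  cases P with
  | nil => simp at hlt
  | cons f P =>
    obtain ⟨c, hfc, hc⟩ := hP.1.of_cons
    have hf : w f < 0 := by
      have := (hP.2.2 c P hc (List.nodup_cons.1 hP.2.1).2).2 (by simp)
      rw [listWeight_cons] at this
      linarith
    have hfs : f ∈ starCut ends b := by
      refine ⟨c, ?_, hfc⟩
      rintro rfl
      have := hcons _ _ (.single hfc) (by simp)
      simp only [listWeight_cons, listWeight_nil] at this
      linarith
    refine ⟨b, f, hfs, hf, fun g hg hwg => hP.unique_neg hcons hg hwg, ?_⟩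
    intro v l hl hnd ht
    by_cases hex : ∃ e ∈ l, e ∈ starCut ends b
    · obtain ⟨e, hel, c, -, hec⟩ := hex
      obtain ⟨A, B, rfl⟩ := List.append_of_mem hel
      rcases hl.split_at_endpoint hec with ⟨h1, h2⟩ | ⟨h1, h2⟩
      · have := hP.sign_nonpos_of_tight hcons hzero (h2.append h1)
          (List.nodup_append_comm.1 hnd) (by simp at ht ⊢; linarith)
        simp only [listWeight_append] at *
        linarith
      · rw [show A ++ e :: B = (A ++ [e]) ++ B by simp] at hnd ht ⊢
        have := hP.sign_nonpos_of_tight hcons hzero (h2.append h1)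
          (List.nodup_append_comm.1 hnd) (by simp at ht ⊢; linarith)
        simp only [listWeight_append] at *
        linarith
    · push Not at hex
      exact listWeight_nonpos _ fun e he => cutSign_nonpos_of_notMem (hex e he)

end Star

section Cycles

variable {V ε : Type} {ends : ε → Sym2 V}

lemma MWalk.exists_verts {u v : V} {l : List ε} (h : MWalk ends u v l) :
    ∃ vs : ℕ → V, vs 0 = u ∧ vs l.length = v ∧
      ∀ i (hi : i < l.length), ends l[i] = s(vs i, vs (i + 1)) := by
  induction h with
  | nil v => exact ⟨fun _ => v, rfl, rfl, by simp⟩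
  | @cons u v z e l he _ ih =>
    obtain ⟨vs, h0, h1, h2⟩ := ih
    refine ⟨fun i => Nat.casesOn i u vs, rfl, h1, ?_⟩
    rintro (_ | i) hi
    · simpa [h0] using he
    · simpa using h2 i (by simpa using hi)

lemma MWalk.of_verts (l : List ε) (vs : ℕ → V)
    (h : ∀ i (hi : i < l.length), ends l[i] = s(vs i, vs (i + 1))) :
    MWalk ends (vs 0) (vs l.length) l := by
  induction l generalizing vs with
  | nil => exact .nil _
  | cons e l ih =>
    refine .cons (h 0 (by simp)) ?_
    exact ih (fun i => vs (i + 1)) fun i hi => h (i + 1) (by simpa using hi)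

lemma IsCycle.exists_trail {C : Finset ε} (hC : IsCycle ends C) :
    ∃ v l, MWalk ends v v l ∧ l.Nodup ∧ l.toFinset = C := by
  obtain ⟨n, v, e, -, he, h, rfl⟩ := hC
  refine ⟨v 0, List.ofFn e, ?_, List.nodup_ofFn.2 he, by ext; simp [-List.ofFn_succ]⟩
  have := MWalk.of_verts (ends := ends) (List.ofFn e) (fun i => v (Fin.ofNat (n + 1) i)) ?_
  · simpa using this
  · intro i hi
    rw [List.length_ofFn] at hi
    have e1 : (⟨i, hi⟩ : Fin (n + 1)) = Fin.ofNat (n + 1) i := by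
      ext; simp [Nat.mod_eq_of_lt hi]
    have e2 : Fin.ofNat (n + 1) (i + 1) = Fin.ofNat (n + 1) i + 1 := by
      ext; simp [Fin.val_add]
    rw [List.getElem_ofFn, h, e1, e2]

lemma MWalk.isCycle {l : List ε} (hl : l ≠ []) (hnd : l.Nodup) (vs : ℕ → V)
    (h : ∀ i (hi : i < l.length), ends l[i] = s(vs i, vs (i + 1)))
    (hclosed : vs l.length = vs 0)
    (hinj : ∀ i j, i < j → j < l.length → vs i ≠ vs j) : IsCycle ends l.toFinset := by
  obtain ⟨n, hn⟩ := Nat.exists_eq_succ_of_ne_zero (List.length_pos_of_ne_nil hl).ne'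
  refine ⟨n, fun i => vs i, fun i => l[i.1]'(by omega), ?_, ?_, ?_, ?_⟩
  · intro i j hij
    by_contra hne
    rcases lt_or_gt_of_ne hne with h1 | h1
    · exact hinj i j h1 (by omega) hij
    · exact hinj j i h1 (by omega) hij.symm
  · intro i j hij
    ext
    exact (List.Nodup.getElem_inj_iff hnd).1 hij
  · intro i
    have hv : vs (i.1 + 1) = vs (i + 1 : Fin (n + 1)).1 := by
      by_cases hi : i = Fin.last n
      · subst hi
        simp only [Fin.val_last, Fin.last_add_one, Fin.val_zero]
        rw [← hclosed, hn]
      · rw [Fin.val_add_one_of_lt (Fin.lt_last_iff_ne_last.2 hi)]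
    simp only
    rw [h, hv]
  · ext e
    simp only [List.mem_toFinset, Finset.mem_image, Finset.mem_univ, true_and, List.mem_iff_getElem]
    constructor
    · rintro ⟨i, hi, rfl⟩
      exact ⟨⟨i, by omega⟩, rfl⟩
    · rintro ⟨i, rfl⟩
      exact ⟨i, by omega, rfl⟩

/-- If all cycles have nonnegative weight, so has every closed walk that repeats only edges of
weight zero. -/
lemma MWalk.weight_nonneg {w : ε → ℝ} (hcyc : ∀ C, IsCycle ends C → 0 ≤ ∑ e ∈ C, w e)
    {v : V} {l : List ε} (h : MWalk ends v v l)
    (hgood : (l.filter fun e => w e ≠ 0).Nodup) : 0 ≤ listWeight w l := by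
  induction hn : l.length using Nat.strong_induction_on generalizing v l with
  | _ n ih =>
  subst hn
  rcases eq_or_ne l [] with rfl | hne
  · simp
  obtain ⟨vs, h0, h1, h2⟩ := h.exists_verts
  by_cases hinj : ∀ i j, i < j → j < l.length → vs i ≠ vs j
  · by_cases hnd : l.Nodup
    · rw [listWeight_eq_sum w hnd]
      exact hcyc _ (MWalk.isCycle hne hnd vs h2 (h1.trans h0.symm) hinj)
    · obtain ⟨i, j, hij, hj, heq⟩ : ∃ i j, ∃ (hij : i < j) (hj : j < l.length), l[i] = l[j] := by
        by_contra! hcon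
        exact hnd (List.pairwise_iff_getElem.2 fun i j hi hj hij => hcon i j hij hj)
      have hw : w l[i] = 0 := by
        by_contra hw
        refine absurd ((List.nodup_iff_count_le_one.1 hgood) l[i]) ?_
        rw [List.count_filter (by simpa using hw), not_le, ← Nat.succ_le_iff]
        refine List.duplicate_iff_two_le_count.1 (List.duplicate_iff_exists_distinct_get.2 ?_)
        exact ⟨⟨i, by omega⟩, ⟨j, hj⟩, hij, rfl, heq⟩
      have hends := h2 i (by omega)
      rw [heq, h2 j hj, Sym2.eq_iff] at hends
      rcases hends with ⟨h3, -⟩ | ⟨h3, h4⟩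
      · exact absurd h3.symm (hinj i j hij hj)
      · have hji : j = i + 1 := by
          by_contra hne'
          exact hinj (i + 1) j (by omega) hj h3.symm
        have hjl : j + 1 = l.length := by
          by_contra hne'
          exact hinj i (j + 1) (by omega) (by omega) h4.symm
        have hi0 : i = 0 := by
          by_contra hne'
          rw [hjl, h1, ← h0] at h4
          exact hinj 0 i (by omega) (by omega) h4
        subst hi0
        obtain ⟨e₁, e₂, rfl⟩ := List.length_eq_two.1 (show l.length = 2 by omega)
        subst hji
        simp only [zero_add, List.getElem_cons_zero, List.getElem_cons_succ] at heq hw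
        simp [← heq, hw]
  · push Not at hinj
    obtain ⟨i, j, hij, hj, heq⟩ := hinj
    have hsplit : l = l.take i ++ ((l.drop i).take (j - i) ++ l.drop j) := by
      conv_lhs => rw [← List.take_append_drop i l, ← List.take_append_drop (j - i) (l.drop i)]
      rw [List.drop_drop, Nat.add_sub_cancel' hij.le]
    have wA : MWalk ends v (vs i) (l.take i) := by
      have := MWalk.of_verts (ends := ends) (l.take i) vs
        (fun k hk => by rw [List.getElem_take]; exact h2 k _)
      rwa [h0, List.length_take, min_eq_left (by omega)] at this
    have wB : MWalk ends (vs i) (vs i) ((l.drop i).take (j - i)) := by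
      have := MWalk.of_verts (ends := ends) ((l.drop i).take (j - i)) (fun k => vs (i + k))
        (fun k hk => by
          rw [List.getElem_take, List.getElem_drop]
          exact h2 (i + k) _)
      rwa [List.length_take, List.length_drop, min_eq_left (by omega), add_zero,
        Nat.add_sub_cancel' hij.le, ← heq] at this
    have wC : MWalk ends (vs i) v (l.drop j) := by
      have := MWalk.of_verts (ends := ends) (l.drop j) (fun k => vs (j + k))
        (fun k hk => by
          rw [List.getElem_drop]
          exact h2 (j + k) _)
      rwa [List.length_drop, add_zero, Nat.add_sub_cancel' hj.le, h1, ← heq] at this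
    have lB : 0 < ((l.drop i).take (j - i)).length := by
      simp only [List.length_take, List.length_drop]; omega
    have lC : 0 < (l.drop j).length := by
      simp only [List.length_drop]; omega
    generalize l.take i = A at *
    generalize (l.drop i).take (j - i) = B at *
    generalize l.drop j = C at *
    subst hsplit
    have i1 := ih _ (by simp; omega) (wA.append wC)
      (hgood.sublist (List.Sublist.filter _ ((List.Sublist.refl A).append
        (List.sublist_append_right B C)))) rfl
    have i2 := ih _ (by simp; omega) wB
      (hgood.sublist (List.Sublist.filter _ ((List.sublist_append_left B C).trans
        (List.sublist_append_right A _)))) rfl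
    simp only [listWeight_append] at *
    linarith

lemma listWeight_filter_ne_zero (w : ε → ℝ) (l : List ε) :
    listWeight w (l.filter fun e => w e ≠ 0) = listWeight w l := by
  induction l with
  | nil => rfl
  | cons e l ih =>
    by_cases he : w e = 0
    · rw [List.filter_cons_of_neg (by simpa using he), ih, listWeight_cons, he, zero_add]
    · rw [List.filter_cons_of_pos (by simpa using he), listWeight_cons, listWeight_cons, ih]

/-- Vertices joined by a walk of weight-zero edges. -/
def zeroSetoid (ends : ε → Sym2 V) (w : ε → ℝ) : Setoid V where
  r u v := ∃ l, MWalk ends u v l ∧ ∀ e ∈ l, w e = 0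
  iseqv :=
    ⟨fun v => ⟨[], .nil v, by simp⟩,
     fun ⟨l, h, h'⟩ => ⟨l.reverse, h.reverse, by simpa using h'⟩,
     fun ⟨l, h, h'⟩ ⟨m, k, k'⟩ => ⟨l ++ m, h.append k, fun e he =>
        (List.mem_append.1 he).elim (h' e) (k' e)⟩⟩

lemma Sym2.exists_of_map_eq {α β : Type} {φ : α → β} {z : Sym2 α} {x y : β}
    (h : z.map φ = s(x, y)) : ∃ p q, z = s(p, q) ∧ φ p = x ∧ φ q = y := by
  induction z using Sym2.ind with
  | _ a b =>
    rw [Sym2.map_mk, Sym2.eq_iff] at h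
    rcases h with ⟨h1, h2⟩ | ⟨h1, h2⟩
    · exact ⟨a, b, rfl, h1, h2⟩
    · exact ⟨b, a, Sym2.eq_swap, h2, h1⟩

lemma MWalk.lift_zeroSetoid {w : ε → ℝ} {x y : Quotient (zeroSetoid ends w)} {l : List ε}
    (h : MWalk (fun e => (ends e).map (Quotient.mk (zeroSetoid ends w))) x y l) {u v : V}
    (hu : Quotient.mk _ u = x) (hv : Quotient.mk _ v = y) :
    ∃ l', MWalk ends u v l' ∧ (l'.filter fun e => w e ≠ 0) = l.filter fun e => w e ≠ 0 := by
  induction h generalizing u with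
  | nil x =>
    obtain ⟨l, hl, h0⟩ := Quotient.exact (hu.trans hv.symm)
    exact ⟨l, hl, by simpa [List.filter_eq_nil_iff] using h0⟩
  | @cons x y z e l he _ ih =>
    obtain ⟨p, q, hpq, hp, hq⟩ := Sym2.exists_of_map_eq he
    obtain ⟨m, hm, h0⟩ := Quotient.exact (hu.trans hp.symm)
    obtain ⟨l', hl', hf⟩ := ih hq hv
    refine ⟨m ++ e :: l', hm.append (.cons hpq hl'), ?_⟩
    have hm0 : (m.filter fun e => w e ≠ 0) = [] := by
      simpa [List.filter_eq_nil_iff] using h0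
    rw [List.filter_append, hm0, List.nil_append, List.filter_cons, List.filter_cons, hf]

variable [Fintype ε]

lemma mem_cutF {U : Set V} {e : ε} :
    e ∈ cutF ends U ↔ ∃ a b, ends e = s(a, b) ∧ a ∈ U ∧ b ∉ U := by
  simp [cutF]

lemma mem_cutF_iff {U : Set V} {e : ε} {a b : V} (he : ends e = s(a, b)) :
    e ∈ cutF ends U ↔ (a ∈ U ∧ b ∉ U) ∨ (b ∈ U ∧ a ∉ U) := by
  rw [mem_cutF]
  constructor
  · rintro ⟨x, y, hxy, hx, hy⟩
    rw [he, Sym2.eq_iff] at hxy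
    rcases hxy with ⟨rfl, rfl⟩ | ⟨rfl, rfl⟩ <;> tauto
  · rintro (h | h)
    · exact ⟨a, b, he, h⟩
    · exact ⟨b, a, he.trans Sym2.eq_swap, h⟩

/-- In a conservatively weighted multigraph with a negative edge, some cut without weight-zero
edges contains exactly one negative edge and crosses every tight cycle in at most as many
positive as negative edges. -/
lemma exists_good_cut {w : ε → ℝ} (hcyc : ∀ C, IsCycle ends C → 0 ≤ ∑ e ∈ C, w e)
    (hneg : ∃ d, w d < 0) :
    ∃ (U : Set V) (f : ε), f ∈ cutF ends U ∧ w f < 0 ∧ (∀ e ∈ cutF ends U, e ≠ f → 0 < w e) ∧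
      ∀ C, IsCycle ends C → ∑ e ∈ C, w e = 0 →
        ∑ e ∈ C, cutSign (cutF ends U : Set ε) f e ≤ 0 := by
  let φ := Quotient.mk (zeroSetoid ends w)
  obtain ⟨b, f, hfb, hf, huniq, htight⟩ := exists_star_cut
    (ends := fun e => (ends e).map φ) (w := w)
    (by
      intro v l hl hnd
      obtain ⟨u, rfl⟩ := Quotient.exists_rep v
      obtain ⟨l', hl', hf⟩ := hl.lift_zeroSetoid rfl rfl
      rw [← listWeight_filter_ne_zero, ← hf, listWeight_filter_ne_zero]
      exact hl'.weight_nonneg hcyc (hf ▸ hnd.filter _))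
    (by
      intro e x y he h0
      obtain ⟨p, q, hpq, rfl, rfl⟩ := Sym2.exists_of_map_eq he
      exact Quotient.sound ⟨[e], .single hpq, by simpa using h0⟩)
    hneg
  have hcut : (cutF ends {v | φ v = b} : Set ε) = starCut (fun e => (ends e).map φ) b := by
    ext e
    simp only [Finset.mem_coe, mem_cutF, starCut, Set.mem_ofPred_eq]
    constructor
    · rintro ⟨p, q, hpq, rfl, hq⟩
      exact ⟨φ q, hq, by rw [hpq]; rfl⟩
    · rintro ⟨c, hc, he⟩
      obtain ⟨p, q, hpq, hp, rfl⟩ := Sym2.exists_of_map_eq he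
      exact ⟨p, q, hpq, hp, hc⟩
  refine ⟨{v | φ v = b}, f, ?_, hf, ?_, ?_⟩
  · rw [← Finset.mem_coe, hcut]; exact hfb
  · intro e he hne
    have he' := he
    rw [← Finset.mem_coe, hcut] at he'
    rcases lt_trichotomy (w e) 0 with h | h | h
    · exact absurd (huniq e he' h) hne
    · obtain ⟨p, q, hpq, hp, hq⟩ := mem_cutF.1 he
      refine absurd ?_ hq
      rw [Set.mem_ofPred_eq] at hp ⊢
      rw [← hp]
      exact Quotient.sound ⟨[e], .single (hpq.trans Sym2.eq_swap), by simpa using h⟩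
    · exact h
  · intro C hC h0
    obtain ⟨v, l, hl, hnd, rfl⟩ := hC.exists_trail
    rw [hcut, ← listWeight_eq_sum _ hnd]
    exact htight _ l (hl.map φ) hnd (by rw [listWeight_eq_sum _ hnd, h0])

open Filter Topology in
/-- The cut of `exists_good_cut` can be subtracted with a small positive multiplicity. -/
lemma exists_improvement {w : ε → ℝ} (hcyc : ∀ C, IsCycle ends C → 0 ≤ ∑ e ∈ C, w e)
    (hneg : ∃ d, w d < 0) :
    ∃ (U : Set V) (f : ε) (t : ℝ), 0 < t ∧ f ∈ cutF ends U ∧ w f + t ≤ 0 ∧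
      (∀ e ∈ cutF ends U, e ≠ f → t ≤ w e ∧ 0 < w e) ∧
      ∀ C, IsCycle ends C → 0 ≤ ∑ e ∈ C, (w e - t * cutSign (cutF ends U : Set ε) f e) := by
  obtain ⟨U, f, hfU, hf, hpos, htight⟩ := exists_good_cut hcyc hneg
  have small : ∀ a : ℝ, 0 < a → ∀ᶠ t in 𝓝[>] (0 : ℝ), t ≤ a := fun a ha =>
    ((eventually_lt_nhds ha).mono fun _ => le_of_lt).filter_mono nhdsWithin_le_nhds
  have h1 : ∀ᶠ t in 𝓝[>] (0 : ℝ), 0 < t := eventually_mem_nhdsWithin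
  have h2 := small (-w f) (by linarith)
  have h3 : ∀ᶠ t in 𝓝[>] (0 : ℝ), ∀ e, e ∈ cutF ends U → e ≠ f → t ≤ w e := by
    refine eventually_all.2 fun e => ?_
    by_cases he : e ∈ cutF ends U ∧ e ≠ f
    · exact (small _ (hpos e he.1 he.2)).mono fun t ht _ _ => ht
    · exact Eventually.of_forall fun t h h' => absurd ⟨h, h'⟩ he
  have h4 : ∀ᶠ t in 𝓝[>] (0 : ℝ), ∀ C : Finset ε, IsCycle ends C →
      0 ≤ ∑ e ∈ C, w e - t * ∑ e ∈ C, cutSign (cutF ends U : Set ε) f e := by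
    refine eventually_all.2 fun C => ?_
    by_cases hC : IsCycle ends C
    swap
    · exact Eventually.of_forall fun t h => absurd h hC
    rcases (hcyc C hC).eq_or_lt with h | h
    · filter_upwards [h1] with t ht _
      have := htight C hC h.symm
      rw [← h]
      nlinarith
    · have hcont : Continuous fun t : ℝ =>
          ∑ e ∈ C, w e - t * ∑ e ∈ C, cutSign (cutF ends U : Set ε) f e := by fun_prop
      have := (hcont.tendsto' 0 _ (by simp)).eventually (lt_mem_nhds h)
      exact (this.filter_mono nhdsWithin_le_nhds).mono fun t ht _ => le_of_lt ht
  obtain ⟨t, ht1, ht2, ht3, ht4⟩ := (h1.and (h2.and (h3.and h4))).exists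
  refine ⟨U, f, t, ht1, hfU, by linarith, fun e he hne => ⟨ht3 e he hne, hpos e he hne⟩, ?_⟩
  intro C hC
  rw [Finset.sum_sub_distrib, ← Finset.mul_sum]
  exact ht4 C hC

end Cycles

section Packing

variable {V ε : Type} {ends : ε → Sym2 V} [Fintype V] [Fintype ε]

/-- Total multiplicity of the cuts containing `e` in the family `y`. -/
def cutLoad (ends : ε → Sym2 V) (y : Finset V → ℝ) (e : ε) : ℝ :=
  ∑ U : Finset V, if e ∈ cutF ends (U : Set V) then y U else 0

lemma continuous_cutLoad (e : ε) : Continuous fun y : Finset V → ℝ => cutLoad ends y e := by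
  unfold cutLoad
  refine continuous_finsetSum _ fun U _ => ?_
  split_ifs <;> fun_prop

lemma le_cutLoad {y : Finset V → ℝ} (hy : ∀ U, 0 ≤ y U) {U : Finset V} {e : ε}
    (he : e ∈ cutF ends (U : Set V)) : y U ≤ cutLoad ends y e := by
  have := Finset.single_le_sum (f := fun U : Finset V => if e ∈ cutF ends (U : Set V) then y U else 0)
    (fun W _ => by split_ifs <;> simp [hy]) (Finset.mem_univ U)
  rwa [if_pos he] at this

lemma cutLoad_add_single (y : Finset V → ℝ) (U : Finset V) (t : ℝ) (e : ε) :
    cutLoad ends (y + Pi.single U t) e =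
      cutLoad ends y e + if e ∈ cutF ends (U : Set V) then t else 0 := by
  have : ∀ W : Finset V,
      (if e ∈ cutF ends (W : Set V) then (y + Pi.single U t : Finset V → ℝ) W else 0) =
        (if e ∈ cutF ends (W : Set V) then y W else 0) +
          if W = U then (if e ∈ cutF ends (U : Set V) then t else 0) else 0 := by
    intro W
    by_cases hW : W = U
    · subst hW
      by_cases h : e ∈ cutF ends (W : Set V) <;> simp [h]
    · split_ifs <;> simp [hW]
  simp only [cutLoad, this, Finset.sum_add_distrib, Finset.sum_ite_eq', Finset.mem_univ, if_true]

lemma sum_cutLoad (Dem : Finset ε) {y : Finset V → ℝ}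
    (hy : ∀ U : Finset V, (cutF ends (U : Set V) ∩ Dem).card ≠ 1 → y U = 0) :
    ∑ e ∈ Dem, cutLoad ends y e = ∑ U, y U := by
  unfold cutLoad
  rw [Finset.sum_comm]
  refine Finset.sum_congr rfl fun U _ => ?_
  rw [← Finset.sum_filter, Finset.sum_const, nsmul_eq_mul]
  have : Dem.filter (fun e => e ∈ cutF ends (U : Set V)) = cutF ends (U : Set V) ∩ Dem := by
    ext; simp [and_comm]
  rw [this]
  by_cases h : (cutF ends (U : Set V) ∩ Dem).card = 1
  · simp [h]
  · simp [hy U h]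

/-- A feasible solution of the cycle LP is saturated by a fractional packing of cuts with exactly
one demand edge each. -/
lemma exists_cut_packing (ends : ε → Sym2 V) (Dem : Finset ε) (x : ε → ℝ)
    (hx : ∀ e ∈ Dem, 0 ≤ x e ∧ x e ≤ 1)
    (hC : ∀ C, IsCycle ends C → ∑ e ∈ C ∩ Dem, x e ≤ ((C \ Dem).card : ℝ)) :
    ∃ y : Finset V → ℝ, (∀ U, 0 ≤ y U) ∧
      (∀ U : Finset V, (cutF ends (U : Set V) ∩ Dem).card ≠ 1 → y U = 0) ∧
      (∀ e, cutLoad ends y e ≤ 1) ∧ ∑ U, y U = ∑ e ∈ Dem, x e := by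
  set c : ε → ℝ := fun e => if e ∈ Dem then x e else 1 with hc
  set σ : ε → ℝ := fun e => if e ∈ Dem then -1 else 1 with hσ
  have hc0 : ∀ e, 0 ≤ c e := fun e => by
    by_cases he : e ∈ Dem <;> simp [hc, he, hx]
  have hc1 : ∀ e, c e ≤ 1 := fun e => by
    by_cases he : e ∈ Dem <;> simp [hc, he, hx]
  let K : Set (Finset V → ℝ) := {y | (∀ U, 0 ≤ y U) ∧
    (∀ U : Finset V, (cutF ends (U : Set V) ∩ Dem).card ≠ 1 → y U = 0) ∧
    (∀ e, cutLoad ends y e ≤ c e) ∧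
    ∀ C, IsCycle ends C → 0 ≤ ∑ e ∈ C, σ e * (c e - cutLoad ends y e)}
  have hclosed : IsClosed K := by
    have hl := fun e => continuous_cutLoad (ends := ends) e
    simp only [K, Set.ofPred_and, Set.ofPred_forall]
    refine IsClosed.inter ?_ (IsClosed.inter ?_ (IsClosed.inter ?_ ?_))
    · exact isClosed_iInter fun U => isClosed_le continuous_const (continuous_apply U)
    · exact isClosed_iInter fun U => isClosed_iInter fun _ =>
        isClosed_eq (continuous_apply U) continuous_const
    · exact isClosed_iInter fun e => isClosed_le (hl e) continuous_const
    · exact isClosed_iInter fun C => isClosed_iInter fun _ => isClosed_le continuous_const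
        (continuous_finsetSum _ fun e _ => continuous_const.mul (continuous_const.sub (hl e)))
  have hcompact : IsCompact K := by
    refine (isCompact_Icc (a := (0 : Finset V → ℝ)) (b := 1)).of_isClosed_subset hclosed ?_
    rintro y ⟨h0, h1, h2, -⟩
    refine ⟨h0, fun U => ?_⟩
    by_cases h : (cutF ends (U : Set V) ∩ Dem).card = 1
    · obtain ⟨e, he⟩ := Finset.card_pos.1 (h ▸ Nat.one_pos)
      exact (le_cutLoad h0 (Finset.mem_inter.1 he).1).trans ((h2 e).trans (hc1 e))
    · rw [h1 U h]; exact zero_le_one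
  have hne : (0 : Finset V → ℝ) ∈ K := by
    refine ⟨fun _ => le_rfl, fun _ _ => rfl, fun e => by simpa [cutLoad] using hc0 e, ?_⟩
    intro C h
    have := hC C h
    have e1 : ∑ e ∈ C, σ e * (c e - cutLoad ends 0 e) =
        ∑ e ∈ C, ((if e ∈ Dem then 0 else 1) - if e ∈ Dem then x e else 0) := by
      refine Finset.sum_congr rfl fun e _ => ?_
      by_cases he : e ∈ Dem <;> simp [hσ, hc, he, cutLoad]
    rw [e1, Finset.sum_sub_distrib, ← Finset.sum_filter, Finset.filter_mem_eq_inter]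
    have e2 : ∑ e ∈ C, (if e ∈ Dem then (0 : ℝ) else 1) = ((C \ Dem).card : ℝ) := by
      rw [Finset.sdiff_eq_filter, Finset.card_filter]
      push_cast
      exact Finset.sum_congr rfl fun e _ => by split_ifs <;> simp_all
    rw [e2]
    linarith
  obtain ⟨y, ⟨hy0, hy1, hy2, hy3⟩, hmax⟩ := hcompact.exists_isMaxOn ⟨0, hne⟩
    (f := fun y : Finset V → ℝ => ∑ U, y U) (by fun_prop)
  refine ⟨y, hy0, hy1, fun e => (hy2 e).trans (hc1 e), ?_⟩
  rw [← sum_cutLoad Dem hy1]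
  refine Finset.sum_congr rfl fun d hd => le_antisymm (by simpa [hc, hd] using hy2 d) ?_
  by_contra! hlt
  have hcd : c d = x d := by simp [hc, hd]
  have hσd : σ d = -1 := by simp [hσ, hd]
  obtain ⟨U, f, t, ht, hfU, hft, hpos, hcyc⟩ := exists_improvement hy3
    ⟨d, by rw [hcd, hσd]; linarith⟩
  have hfD : f ∈ Dem := by
    by_contra h
    have := hy2 f
    have : σ f = 1 := by simp [hσ, h]
    rw [this] at hft
    linarith
  have honly : ∀ e ∈ cutF ends U, e ≠ f → e ∉ Dem := by
    intro e he hne h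
    have h1 := (hpos e he hne).2
    have h2 : σ e = -1 := by simp [hσ, h]
    have := hy2 e
    rw [h2] at h1
    linarith
  have hUc : ((U.toFinset : Finset V) : Set V) = U := Set.coe_toFinset U
  have hmem : y + Pi.single U.toFinset t ∈ K := by
    refine ⟨fun W => ?_, fun W hW => ?_, fun e => ?_, fun C h => ?_⟩
    · exact add_nonneg (hy0 W) ((Pi.single_nonneg (α := fun _ => ℝ)).2 ht.le W)
    · have : W ≠ U.toFinset := by
        rintro rfl
        refine hW (Finset.card_eq_one.2 ⟨f, ?_⟩)
        ext e
        rw [Finset.mem_inter, Finset.mem_singleton, hUc]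
        constructor
        · rintro ⟨h1, h2⟩
          by_contra hne
          exact honly e h1 hne h2
        · rintro rfl; exact ⟨hfU, hfD⟩
      simp [this, hy1 W hW]
    · rw [cutLoad_add_single, hUc]
      split_ifs with he
      · by_cases hef : e = f
        · subst hef
          have : σ e = -1 := by simp [hσ, hfD]
          rw [this] at hft
          linarith
        · have h1 := (hpos e he hef).1
          have : σ e = 1 := by simp [hσ, honly e he hef]
          rw [this] at h1
          linarith
      · simpa using hy2 e
    · refine (hcyc C h).trans_eq (Finset.sum_congr rfl fun e _ => ?_)
      rw [cutLoad_add_single, hUc]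
      by_cases hef : e = f
      · subst hef
        simp only [cutSign, if_true, if_pos hfU, hσ, if_pos hfD]
        ring
      · by_cases he : e ∈ cutF ends U
        · simp only [cutSign, if_neg hef, Finset.mem_coe, if_pos he, hσ, if_neg (honly e he hef)]
          ring
        · simp only [cutSign, if_neg hef, Finset.mem_coe, if_neg he]
          ring
  have := hmax hmem
  simp only [Set.mem_ofPred_eq, Pi.add_apply, Finset.sum_add_distrib, Finset.sum_pi_single',
    Finset.mem_univ, if_true] at this
  linarith

end Packing

section SimpleCuts

variable {V ε : Type} {ends : ε → Sym2 V}

/-- The connected component of `a` in the subgraph induced by `S`. -/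
def compOn (ends : ε → Sym2 V) (S : Set V) (a : V) : Set V :=
  {v | Relation.ReflTransGen (fun x y => x ∈ S ∧ y ∈ S ∧ ∃ e, ends e = s(x, y)) a v}

lemma compOn_subset {S : Set V} {a : V} (ha : a ∈ S) : compOn ends S a ⊆ S := by
  intro v hv
  cases hv with
  | refl => exact ha
  | tail _ h => exact h.2.1

lemma compOn_step {S : Set V} {a x y : V} {e : ε} (ha : a ∈ S) (hx : x ∈ compOn ends S a)
    (hy : y ∈ S) (he : ends e = s(x, y)) : y ∈ compOn ends S a :=
  Relation.ReflTransGen.tail hx ⟨compOn_subset ha hx, hy, e, he⟩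

lemma reflTransGen_symm (S : Set V) {a b : V}
    (h : Relation.ReflTransGen (fun x y => x ∈ S ∧ y ∈ S ∧ ∃ e, ends e = s(x, y)) a b) :
    Relation.ReflTransGen (fun x y => x ∈ S ∧ y ∈ S ∧ ∃ e, ends e = s(x, y)) b a :=
  haveI : Std.Symm (fun x y => x ∈ S ∧ y ∈ S ∧ ∃ e, ends e = s(x, y)) :=
    ⟨fun _ _ ⟨hx, hy, e, he⟩ => ⟨hy, hx, e, he.trans Sym2.eq_swap⟩⟩
  Relation.ReflTransGen.stdSymm.symm _ _ h

lemma connectedOn_of_root {S : Set V} {a : V} (ha : a ∈ S)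
    (h : ∀ v ∈ S, Relation.ReflTransGen
      (fun x y => x ∈ S ∧ y ∈ S ∧ ∃ e, ends e = s(x, y)) a v) : ConnectedOn ends S :=
  ⟨⟨a, ha⟩, fun u hu v hv => (reflTransGen_symm S (h u hu)).trans (h v hv)⟩

lemma connectedOn_compOn {S : Set V} {a : V} (ha : a ∈ S) :
    ConnectedOn ends (compOn ends S a) := by
  refine connectedOn_of_root Relation.ReflTransGen.refl fun v hv => ?_
  induction hv with
  | refl => exact .refl
  | @tail x y hx hxy ih =>
    obtain ⟨e, he⟩ := hxy.2.2
    exact ih.tail ⟨hx, compOn_step ha hx hxy.2.1 he, e, he⟩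

variable [Fintype ε]

lemma cutF_compl (U : Set V) : cutF ends Uᶜ = cutF ends U := by
  ext e
  obtain ⟨a, b, he⟩ : ∃ a b, ends e = s(a, b) := by
    induction ends e using Sym2.ind with
    | _ x y => exact ⟨x, y, rfl⟩
  rw [mem_cutF_iff he, mem_cutF_iff he]
  simp only [Set.mem_compl_iff]
  tauto

lemma cutF_compOn_subset {S : Set V} {a : V} (ha : a ∈ S) :
    cutF ends (compOn ends S a) ⊆ cutF ends S := by
  intro e he
  obtain ⟨x, y, hxy, hx, hy⟩ := mem_cutF.1 he
  exact mem_cutF.2 ⟨x, y, hxy, compOn_subset ha hx, fun h => hy (compOn_step ha hx h hxy)⟩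

/-- In a connected multigraph every cut edge lies in a simple cut contained in the given cut. -/
lemma exists_isSimpleCut (hconn : MGConnected ends) {U : Set V} {f : ε} (hf : f ∈ cutF ends U) :
    ∃ W, IsSimpleCut ends W ∧ cutF ends W ⊆ cutF ends U ∧ f ∈ cutF ends W := by
  obtain ⟨a, b, hab, ha, hb⟩ := mem_cutF.1 hf
  set A := compOn ends U a with hA
  have haA : a ∈ A := Relation.ReflTransGen.refl
  have hbA : b ∈ Aᶜ := fun h => hb (compOn_subset ha h)
  set B := compOn ends Aᶜ b with hB
  have hbB : b ∈ B := Relation.ReflTransGen.refl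
  have hAB : A ⊆ Bᶜ := fun v hv h => compOn_subset hbA h hv
  refine ⟨B, ⟨connectedOn_compOn hbA, ?_⟩, ?_, ?_⟩
  · refine connectedOn_of_root (hAB haA) fun v hv => reflTransGen_symm _ ?_
    have hva := hconn.2 v trivial a trivial
    induction hva using Relation.ReflTransGen.head_induction_on with
    | refl => exact .refl
    | @head v z hvz _ ih =>
      by_cases hvA : v ∈ A
      · refine Relation.ReflTransGen.mono ?_ _ _ ((connectedOn_compOn ha).2 v hvA a haA)
        rintro p q ⟨hp, hq, h⟩
        exact ⟨hAB hp, hAB hq, h⟩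
      · obtain ⟨-, -, e, he⟩ := hvz
        have hz : z ∈ Bᶜ := fun h => hv (compOn_step hbA h hvA (he.trans Sym2.eq_swap))
        exact (ih hz).head ⟨hv, hz, e, he⟩
  · refine (cutF_compOn_subset hbA).trans ?_
    rw [cutF_compl]
    exact cutF_compOn_subset ha
  · exact mem_cutF.2 ⟨b, a, hab.trans Sym2.eq_swap, hbB, hAB haA⟩

lemma MWalk.even_crossings (U : Set V) {u v : V} {l : List ε} (h : MWalk ends u v l) :
    Even (l.filter fun e => e ∈ cutF ends U).length ↔ (u ∈ U ↔ v ∈ U) := by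
  induction h with
  | nil => simp
  | @cons u v z e l he _ ih =>
    have := mem_cutF_iff (U := U) he
    rw [List.filter_cons]
    split_ifs with h
    · rw [List.length_cons, Nat.even_add_one, ih]
      have := this.1 (by simpa using h)
      tauto
    · rw [ih]
      have := mt this.2 (by simpa using h)
      tauto

lemma IsCycle.even_crossings {C : Finset ε} (hC : IsCycle ends C) (U : Set V) :
    Even (C ∩ cutF ends U).card := by
  obtain ⟨v, l, hl, hnd, rfl⟩ := hC.exists_trail
  have : l.toFinset ∩ cutF ends U = (l.filter fun e => e ∈ cutF ends U).toFinset := by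
    ext; simp
  rw [this, List.toFinset_card_of_nodup (hnd.filter _), hl.even_crossings U]

/-- A cycle meets a cut with one demand edge in at least as many supply as demand edges. -/
lemma IsCycle.card_demand_le {C Dem : Finset ε} (hC : IsCycle ends C) {U : Set V}
    (hU : (cutF ends U ∩ Dem).card = 1) :
    ((C ∩ Dem).filter fun e => e ∈ cutF ends U).card ≤
      ((C \ Dem).filter fun e => e ∈ cutF ends U).card := by
  have h1 : ((C ∩ Dem).filter fun e => e ∈ cutF ends U).card ≤ 1 := by
    rw [← hU]
    exact Finset.card_le_card fun e he => by simp at he ⊢; tauto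
  have h2 : ((C ∩ Dem).filter fun e => e ∈ cutF ends U).card +
      ((C \ Dem).filter fun e => e ∈ cutF ends U).card = (C ∩ cutF ends U).card := by
    rw [← Finset.card_union_of_disjoint]
    · congr 1
      ext e
      simp
      tauto
    · rw [Finset.disjoint_left]
      intro e he
      simp at he ⊢
      tauto
  obtain ⟨k, hk⟩ := hC.even_crossings U
  omega

end SimpleCuts

section LP

variable {V ε : Type} [Fintype V] [Fintype ε] (ends : ε → Sym2 V) (Dem : Finset ε)

/-- A fractional packing of `D`-cuts gives a feasible solution of the cycle LP of equal value. -/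
lemma exists_cycle_solution {f : Finset V → ℝ} (hf : ∀ U, 0 ≤ f U)
    (hcap : ∀ e, ∑ U ∈ Finset.univ.filter
      (fun U : Finset V => IsDCut ends Dem ↑U ∧ e ∈ cutF ends ↑U), f U ≤ 1) :
    ∃ x : ε → ℝ, (∀ e ∈ Dem, 0 ≤ x e ∧ x e ≤ 1) ∧
      (∀ C : Finset ε, IsCycle ends C → ∑ e ∈ C ∩ Dem, x e ≤ ((C \ Dem).card : ℝ)) ∧
      ∑ U ∈ Finset.univ.filter (fun U : Finset V => IsDCut ends Dem ↑U), f U =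
        ∑ e ∈ Dem, x e := by
  set x : ε → ℝ := fun e => ∑ U ∈ Finset.univ.filter
    (fun U : Finset V => IsDCut ends Dem ↑U ∧ e ∈ cutF ends ↑U), f U with hx
  have hsum : ∀ S : Finset ε, ∑ e ∈ S, x e =
      ∑ U ∈ Finset.univ.filter (fun U : Finset V => IsDCut ends Dem ↑U),
        ((S.filter fun e => e ∈ cutF ends (U : Set V)).card : ℝ) * f U := by
    intro S
    simp only [hx, ← Finset.filter_filter]
    rw [Finset.sum_congr rfl fun e _ => Finset.sum_filter _ _, Finset.sum_comm]
    refine Finset.sum_congr rfl fun U _ => ?_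
    rw [← Finset.sum_filter, Finset.sum_const, nsmul_eq_mul]
  refine ⟨x, fun e _ => ⟨Finset.sum_nonneg fun U _ => hf U, hcap e⟩, fun C hC => ?_, ?_⟩
  · calc ∑ e ∈ C ∩ Dem, x e ≤ ∑ e ∈ C \ Dem, x e := by
          rw [hsum, hsum]
          refine Finset.sum_le_sum fun U hU => mul_le_mul_of_nonneg_right ?_ (hf U)
          exact_mod_cast hC.card_demand_le (Finset.mem_filter.1 hU).2.2
      _ ≤ ∑ e ∈ C \ Dem, (1 : ℝ) := Finset.sum_le_sum fun e _ => hcap e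
      _ = ((C \ Dem).card : ℝ) := by simp
  · rw [hsum]
    refine Finset.sum_congr rfl fun U hU => ?_
    have h1 : Dem.filter (fun e => e ∈ cutF ends (U : Set V)) = cutF ends (U : Set V) ∩ Dem := by
      ext; simp [and_comm]
    rw [h1, (Finset.mem_filter.1 hU).2.2, Nat.cast_one, one_mul]

variable {ends Dem}

lemma exists_isDCut (hconn : MGConnected ends) (U : Finset V)
    (hU : (cutF ends (U : Set V) ∩ Dem).card = 1) :
    ∃ W : Finset V, IsDCut ends Dem ↑W ∧ cutF ends (W : Set V) ⊆ cutF ends (U : Set V) := by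
  obtain ⟨f, hf⟩ := Finset.card_eq_one.1 hU
  have hfm : f ∈ cutF ends (U : Set V) ∩ Dem := by simp [hf]
  obtain ⟨W, hW, hsub, hfW⟩ := exists_isSimpleCut hconn (Finset.mem_inter.1 hfm).1
  refine ⟨W.toFinset, ⟨by simpa using hW, ?_⟩, by simpa using hsub⟩
  rw [Set.coe_toFinset]
  refine le_antisymm (hU ▸ Finset.card_le_card (Finset.inter_subset_inter_right hsub)) ?_
  exact Finset.card_pos.2 ⟨f, Finset.mem_inter.2 ⟨hfW, (Finset.mem_inter.1 hfm).2⟩⟩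

/-- A feasible solution of the cycle LP gives a fractional packing of `D`-cuts of equal value. -/
lemma exists_dCut_packing (hconn : MGConnected ends) {x : ε → ℝ}
    (hx : ∀ e ∈ Dem, 0 ≤ x e ∧ x e ≤ 1)
    (hC : ∀ C : Finset ε, IsCycle ends C → ∑ e ∈ C ∩ Dem, x e ≤ ((C \ Dem).card : ℝ)) :
    ∃ f : Finset V → ℝ, (∀ U, 0 ≤ f U) ∧
      (∀ e, ∑ U ∈ Finset.univ.filter
        (fun U : Finset V => IsDCut ends Dem ↑U ∧ e ∈ cutF ends ↑U), f U ≤ 1) ∧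
      ∑ e ∈ Dem, x e =
        ∑ U ∈ Finset.univ.filter (fun U : Finset V => IsDCut ends Dem ↑U), f U := by
  obtain ⟨y, hy0, hy1, hcap, hsum⟩ := exists_cut_packing ends Dem x hx hC
  have hg : ∀ U : Finset V, ∃ W : Finset V, (cutF ends (U : Set V) ∩ Dem).card = 1 →
      IsDCut ends Dem ↑W ∧ cutF ends (W : Set V) ⊆ cutF ends (U : Set V) := by
    intro U
    by_cases h : (cutF ends (U : Set V) ∩ Dem).card = 1
    · exact (exists_isDCut hconn U h).imp fun W hW _ => hW
    · exact ⟨U, fun h' => absurd h' h⟩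
  choose g hg using hg
  refine ⟨fun W => ∑ U ∈ Finset.univ.filter (fun U => g U = W), y U,
    fun W => Finset.sum_nonneg fun U _ => hy0 U, fun e => ?_, ?_⟩
  · rw [Finset.sum_fiberwise_eq_sum_filter]
    refine le_trans ?_ (hcap e)
    rw [cutLoad, Finset.sum_filter]
    refine Finset.sum_le_sum fun U _ => ?_
    by_cases h : (cutF ends (U : Set V) ∩ Dem).card = 1
    · split_ifs with h1 h2 h2
      · exact le_rfl
      · exact absurd ((hg U h).2 (Finset.mem_filter.1 h1).2.2) h2
      · exact hy0 U
      · exact le_rfl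
    · simp [hy1 U h]
  · rw [Finset.sum_fiberwise_eq_sum_filter, ← hsum, Finset.sum_filter]
    refine Finset.sum_congr rfl fun U _ => ?_
    by_cases h : (cutF ends (U : Set V) ∩ Dem).card = 1
    · simp [(hg U h).1]
    · simp [hy1 U h]

end LP

/-- the optimum value of the `D`-cut packing LP equals the optimum value of
the nonnegative cycle LP. -/
theorem stmt7 {V ε : Type} [Fintype V] [DecidableEq V] [Fintype ε] [DecidableEq ε]
    (ends : ε → Sym2 V) (Dem : Finset ε)
    (hconn : MGConnected ends) :
    sSup {r : ℝ | ∃ f : Finset V → ℝ,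
        (∀ U : Finset V, 0 ≤ f U) ∧
        (∀ e : ε, ∑ U ∈ Finset.univ.filter
            (fun U : Finset V => IsDCut ends Dem ↑U ∧ e ∈ cutF ends ↑U), f U ≤ 1) ∧
        r = ∑ U ∈ Finset.univ.filter (fun U : Finset V => IsDCut ends Dem ↑U), f U}
      = sSup {r : ℝ | ∃ x : ε → ℝ,
        (∀ e ∈ Dem, 0 ≤ x e ∧ x e ≤ 1) ∧
        (∀ C : Finset ε, IsCycle ends C → ∑ e ∈ C ∩ Dem, x e ≤ ((C \ Dem).card : ℝ)) ∧
        r = ∑ e ∈ Dem, x e} := by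
  rename_i _ _ _ instε
  obtain rfl : instε = fun a b => Classical.propDecidable (a = b) := Subsingleton.elim _ _
  congr 1
  ext r
  constructor
  · rintro ⟨f, hf, hcap, rfl⟩
    exact exists_cycle_solution ends Dem hf hcap
  · rintro ⟨x, hx, hC, rfl⟩
    exact exists_dCut_packing hconn hx hC

end
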